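/- Every matroid M admits a lean tree-decomposition of width tw(M). -/

import Mathlib

open scoped Classical

noncomputable section

/-- An oriented separation of `V`: an ordered pair of subsets. -/
abbrev OSep (V : Type*) := Set V × Set V

namespace OSep

/-- The involution `(A,B)* = (B,A)`. -/
def flip {V : Type*} (s : OSep V) : OSep V := (s.2, s.1)

/-- The partial order `(A,B) ≤ (C,D) iff A ⊆ C and D ⊆ B`. -/
def le {V : Type*} (s t : OSep V) : Prop := s.1 ⊆ t.1 ∧ t.2 ⊆ s.2

/-- The infimum `(A,B) ∧ (C,D) = (A ∩ C, B ∪ D)`. -/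
def inter {V : Type*} (s t : OSep V) : OSep V := (s.1 ∩ t.1, s.2 ∪ t.2)

/-- The supremum `(A,B) ∨ (C,D) = (A ∪ C, B ∩ D)`. -/
def union {V : Type*} (s t : OSep V) : OSep V := (s.1 ∪ t.1, s.2 ∩ t.2)

end OSep

/-- A universe of set separations: a set of oriented separations (pairs covering `V`)
closed under the involution and under ∧ and ∨. -/
structure IsUniverse {V : Type*} (S : Set (OSep V)) : Prop where
  covers : ∀ s ∈ S, s.1 ∪ s.2 = Set.univ
  flip_mem : ∀ s ∈ S, s.flip ∈ S
  inter_mem : ∀ s ∈ S, ∀ t ∈ S, s.inter t ∈ S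
  union_mem : ∀ s ∈ S, ∀ t ∈ S, s.union t ∈ S

/-- An order function on a universe `S`: symmetric and submodular (non-negativity is
automatic for `ℕ`-valued functions). -/
structure IsOrderFun {V : Type*} (S : Set (OSep V)) (ord : OSep V → ℕ) : Prop where
  symm : ∀ s ∈ S, ord s.flip = ord s
  submod : ∀ s ∈ S, ∀ t ∈ S, ord (s.inter t) + ord (s.union t) ≤ ord s + ord t

/-- A universe with an order function is grounded if `|A ∪ C, B ∩ D| ≤ |C,D|`
whenever `(B,A) ≤ (C,D)`. -/
def Grounded {V : Type*} (S : Set (OSep V)) (ord : OSep V → ℕ) : Prop :=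
  ∀ s ∈ S, ∀ t ∈ S, OSep.le s.flip t → ord (s.union t) ≤ ord t

/-- A submodular function on subsets of `V`. -/
def Submodular {V : Type*} (r : Set V → ℕ) : Prop :=
  ∀ X Y : Set V, r (X ∩ Y) + r (X ∪ Y) ≤ r X + r Y

/-- The order function `|X,Y|_r = r(X) + r(Y) - r(V)` induced by `r`. -/
def ordOf {V : Type*} (r : Set V → ℕ) (s : OSep V) : ℕ := r s.1 + r s.2 - r Set.univ

/-- A multiset of oriented separations is a star if `(A,B) ≤ (D,C)` for every two of its
members occupying distinct positions. -/
def IsStar {V : Type*} (σ : Multiset (OSep V)) : Prop :=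
  ∀ a b : OSep V, (a ::ₘ {b}) ≤ σ → OSep.le a b.flip

/-- The size `⟨σ⟩_r = Σᵢ r(Bᵢ) − n · r(V)` of a star `σ = {(A₀,B₀),…,(Aₙ,Bₙ)}`. -/
def starSize {V : Type*} (r : Set V → ℕ) (σ : Multiset (OSep V)) : ℕ :=
  (σ.map fun s => r s.2).sum - (Multiset.card σ - 1) * r Set.univ

/-- `λ((A,B),(C,D)) = min { |X,Y| : (X,Y) ∈ S, (A,B) ≤ (X,Y) ≤ (C,D) }`. -/
def lam {V : Type*} (S : Set (OSep V)) (ord : OSep V → ℕ) (a c : OSep V) : ℕ :=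
  sInf (ord '' {s | s ∈ S ∧ OSep.le a s ∧ OSep.le s c})

/-- `(X,Y)` is linked to `(A,B)` if `(A,B) ≤ (X,Y)` and `|X,Y| = λ((A,B),(X,Y))`. -/
def IsLinkedSep {V : Type*} (S : Set (OSep V)) (ord : OSep V → ℕ) (a x : OSep V) : Prop :=
  x ∈ S ∧ OSep.le a x ∧ ord x = lam S ord a x

/-- `σ_t`: the multiset of labels of the oriented edges (darts) pointing towards `t`. -/
def starAt {W : Type*} [Fintype W] {V : Type*} (T : SimpleGraph W) (α : T.Dart → OSep V)
    (t : W) : Multiset (OSep V) :=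
  ((Finset.univ : Finset T.Dart).filter fun d => d.toProd.2 = t).val.map α

/-- The natural ordering on the oriented edges (darts) of a tree: `d ≤ d'` iff both lie
(in that direction) on the path from the tail of `d` to the head of `d'`. -/
def dartLE {W : Type*} (T : SimpleGraph W) (d d' : T.Dart) : Prop :=
  ∀ p : T.Walk d.toProd.1 d'.toProd.2, p.IsPath → d ∈ p.darts ∧ d' ∈ p.darts

/-- The vertex set of the subtree `T(e⃗)`: the component of `T - x` containing `y` together
with `x` itself, for `e⃗ = (x,y)`. -/
def shiftSet {W : Type*} (T : SimpleGraph W) (e : T.Dart) : Set W :=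
  {v | v = e.toProd.1 ∨ ∀ p : T.Walk e.toProd.1 v, p.IsPath → e ∈ p.darts}

/-- A dart of an induced subgraph, as a dart of the ambient graph. -/
def liftDart {W : Type*} {T : SimpleGraph W} {U : Set W} (d : (T.induce U).Dart) : T.Dart :=
  ⟨(d.toProd.1.val, d.toProd.2.val), d.adj⟩

/-- The labelling `α'` of the shift of `(T,α)` onto `(X,Y)` with respect to `e⃗`:
a dart `f` of `T(e⃗)` with `e⃗ ≤ f⃗` gets `α(f⃗) ∨ (X,Y)`, and the reverse darts get the
flipped labels. -/
def shiftAlpha {W : Type*} {V : Type*} (T : SimpleGraph W) (α : T.Dart → OSep V)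
    (e : T.Dart) (X : OSep V) : (T.induce (shiftSet T e)).Dart → OSep V :=
  fun d =>
    if dartLE T e (liftDart d) then (α (liftDart d)).union X
    else ((α (liftDart d).symm).union X).flip

/-- A family `F` of stars is fixed under shifting if for every tame `S`-tree `(T,α)`,
every oriented edge `e⃗ = (t,t')` of `T`, every vertex `s ≠ t` of `T(e⃗)` with
`α(F⃗_s) ∈ F`, and every `(X,Y)` linked to `α(e⃗)`, in the shift of `(T,α)` onto `(X,Y)`
with respect to `e⃗` one has `α'(F⃗_s) ∈ F`. -/
def FixedUnderShifting {V : Type*} (S : Set (OSep V)) (ord : OSep V → ℕ)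
    (F : Set (Multiset (OSep V))) : Prop :=
  ∀ (n : ℕ) (T : SimpleGraph (Fin n)) (α : T.Dart → OSep V) (e : T.Dart) (X : OSep V)
    (s : ↥(shiftSet T e)),
    T.IsTree → (∀ d, α d.symm = (α d).flip) → (∀ d, α d ∈ S) →
    (∀ t, IsStar (starAt T α t)) →
    (s : Fin n) ≠ e.toProd.1 → starAt T α (s : Fin n) ∈ F →
    IsLinkedSep S ord (α e) X →
    starAt (T.induce (shiftSet T e)) (shiftAlpha T α e X) s ∈ F

/-- A linked `S_k`-tree: for every two darts `e⃗ ≤ f⃗`, the minimum order of a label on the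
path from `e` to `f` equals `λ(α(e⃗), α(f⃗))`. -/
def IsLinkedTree {W : Type*} {V : Type*} (S : Set (OSep V)) (ord : OSep V → ℕ)
    (T : SimpleGraph W) (α : T.Dart → OSep V) : Prop :=
  ∀ e f : T.Dart, dartLE T e f →
    sInf ((fun g => ord (α g)) '' {g | dartLE T e g ∧ dartLE T g f}) =
      lam S ord (α e) (α f)

/-- An `F`-lean `S_k`-tree with respect to the ground function `r`. -/
def IsLeanTree {W : Type*} [Fintype W] {V : Type*} (S : Set (OSep V)) (ord : OSep V → ℕ)
    (r : Set V → ℕ) (T : SimpleGraph W) (α : T.Dart → OSep V)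
    (F : Set (Multiset (OSep V))) : Prop :=
  ∀ (t t' : W) (a b : OSep V), OSep.le a b.flip →
    (a ::ₘ starAt T α t) ∈ F → (b ::ₘ starAt T α t') ∈ F →
    (min (r a.1) (r b.1) ≤ lam S ord a b.flip ∨
      ∀ p : T.Walk t t', p.IsPath →
        sInf ((fun d => ord (α d)) '' {d | d ∈ p.darts}) = lam S ord a b.flip)

/-- `int(σ) = ⋂ᵢ Bᵢ` for `σ = {(A₀,B₀),…,(Aₙ,Bₙ)}`. -/
def intStar {V : Type*} (σ : Multiset (OSep V)) : Set V := {v | ∀ s ∈ σ, v ∈ s.2}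

/-- The universe of oriented separations of a graph `G`: pairs `(A,B)` of vertex sets with
`A ∪ B = V(G)` and no edge between `A ∖ B` and `B ∖ A`. -/
def graphSeps {V : Type*} (G : SimpleGraph V) : Set (OSep V) :=
  {s | s.1 ∪ s.2 = Set.univ ∧ ∀ a ∈ s.1 \ s.2, ∀ b ∈ s.2 \ s.1, ¬ G.Adj a b}

/-- `G` contains `k` vertex-disjoint `Z₁`–`Z₂` paths. -/
def HasDisjointPaths {V : Type*} (G : SimpleGraph V) (Z₁ Z₂ : Set V) (k : ℕ) : Prop :=
  ∃ (u v : Fin k → V) (p : ∀ i, G.Walk (u i) (v i)),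
    (∀ i, (p i).IsPath) ∧ (∀ i, u i ∈ Z₁) ∧ (∀ i, v i ∈ Z₂) ∧
    ∀ i j, i ≠ j → ∀ x, x ∈ (p i).support → x ∉ (p j).support

/-- `(T, B)` is a tree-decomposition of the graph `G`. -/
def IsTreeDecomp {V : Type*} {n : ℕ} (G : SimpleGraph V) (T : SimpleGraph (Fin n))
    (B : Fin n → Set V) : Prop :=
  T.IsTree ∧ (∀ v, ∃ t, v ∈ B t) ∧ (∀ u w, G.Adj u w → ∃ t, u ∈ B t ∧ w ∈ B t) ∧
  (∀ t₁ t₂ t₃ : Fin n, ∀ p : T.Walk t₁ t₃, p.IsPath → t₂ ∈ p.support → B t₁ ∩ B t₃ ⊆ B t₂)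

/-- The width of a tree-decomposition: `max |V_t| − 1`. -/
def tdWidth {V : Type*} {n : ℕ} (B : Fin n → Set V) : ℕ :=
  (Finset.univ.sup fun t => (B t).ncard) - 1

/-- The tree-width of a graph. -/
def treeWidth {V : Type*} (G : SimpleGraph V) : ℕ :=
  sInf {w | ∃ (n : ℕ) (T : SimpleGraph (Fin n)) (B : Fin n → Set V),
    IsTreeDecomp G T B ∧ tdWidth B = w}

/-- The path-width of a graph: minimum width of a tree-decomposition whose tree is a path. -/
def pathWidth {V : Type*} (G : SimpleGraph V) : ℕ :=
  sInf {w | ∃ (n : ℕ) (B : Fin n → Set V),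
    IsTreeDecomp G (SimpleGraph.pathGraph n) B ∧ tdWidth B = w}

/-- A linked tree-decomposition of a graph. -/
def IsLinkedDecomp {V : Type*} {n : ℕ} (G : SimpleGraph V) (T : SimpleGraph (Fin n))
    (B : Fin n → Set V) : Prop :=
  ∀ (k : ℕ) (t t' : Fin n),
    HasDisjointPaths G (B t) (B t') k ∨
    ∀ p : T.Walk t t', p.IsPath →
      ∃ d ∈ p.darts, (B d.toProd.1 ∩ B d.toProd.2).ncard < k

/-- A lean tree-decomposition of a graph. -/
def IsLeanDecomp {V : Type*} {n : ℕ} (G : SimpleGraph V) (T : SimpleGraph (Fin n))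
    (B : Fin n → Set V) : Prop :=
  ∀ (k : ℕ) (t t' : Fin n) (Z₁ Z₂ : Set V), Z₁ ⊆ B t → Z₂ ⊆ B t' →
    Z₁.ncard = k → Z₂.ncard = k →
    HasDisjointPaths G Z₁ Z₂ k ∨
    ∀ p : T.Walk t t', p.IsPath →
      ∃ d ∈ p.darts, (B d.toProd.1 ∩ B d.toProd.2).ncard < k
/-- The rank function of a matroid: `r(X)` is the maximum size of an independent subset
of `X`. -/
def mRank {α : Type*} (M : Matroid α) (X : Set α) : ℕ :=
  sSup {k | ∃ I, I ⊆ X ∧ M.Indep I ∧ I.ncard = k}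

/-- The connectivity `λ(X) = r(X) + r(E ∖ X) − r(E)` of `X ⊆ E`. -/
def mConn {α : Type*} (M : Matroid α) (X : Set α) : ℕ :=
  mRank M X + mRank M Xᶜ - mRank M Set.univ

/-- For a dart `d = (s,s')` of a tree `T`, the component of `T − s'` containing `s`. -/
def branch {W : Type*} (T : SimpleGraph W) (d : T.Dart) : Set W :=
  {w | ∀ p : T.Walk d.toProd.2 w, p.IsPath → d.toProd.1 ∈ p.support}

/-- The darts of `T` pointing towards `t`. -/
def dartsTo {W : Type*} [Fintype W] (T : SimpleGraph W) (t : W) : Finset T.Dart :=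
  Finset.univ.filter fun d => d.toProd.2 = t

/-- The width `Σᵢ r(E ∖ τ⁻¹(Tᵢ)) − (d−1)·r(E)` of the bag of a matroid tree-decomposition
at `v`, where the `Tᵢ` are the components of `T − v`. -/
def mBagWidth {α : Type*} {n : ℕ} (M : Matroid α) (T : SimpleGraph (Fin n))
    (τ : α → Fin n) (v : Fin n) : ℕ :=
  ((∑ d ∈ dartsTo T v, mRank M ((τ ⁻¹' branch T d)ᶜ)) + mRank M Set.univ)
    - (dartsTo T v).card * mRank M Set.univ

/-- The width of a matroid tree-decomposition: the maximum width of a bag. -/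
def mWidth {α : Type*} {n : ℕ} (M : Matroid α) (T : SimpleGraph (Fin n))
    (τ : α → Fin n) : ℕ :=
  Finset.univ.sup (mBagWidth M T τ)

/-- The tree-width of a matroid. -/
def matroidTreeWidth {α : Type*} (M : Matroid α) : ℕ :=
  sInf {w | ∃ (n : ℕ) (T : SimpleGraph (Fin n)) (_ : T.IsTree) (τ : α → Fin n),
    mWidth M T τ = w}

/-- `λ(Z₁,Z₂) = min {λ(X) : Z₁ ⊆ X ⊆ E ∖ Z₂}` for disjoint `Z₁, Z₂ ⊆ E`. -/
def mLam {α : Type*} (M : Matroid α) (Z₁ Z₂ : Set α) : ℕ :=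
  sInf (mConn M '' {X | Z₁ ⊆ X ∧ X ⊆ Z₂ᶜ})

/-- A lean matroid tree-decomposition. -/
def IsLeanMDecomp {α : Type*} {n : ℕ} (M : Matroid α) (T : SimpleGraph (Fin n))
    (τ : α → Fin n) : Prop :=
  ∀ (k : ℕ) (t t' : Fin n) (Z₁ Z₂ : Set α), Z₁ ⊆ τ ⁻¹' {t} → Z₂ ⊆ τ ⁻¹' {t'} →
    Disjoint Z₁ Z₂ → mRank M Z₁ = k → mRank M Z₂ = k →
    k ≤ mLam M Z₁ Z₂ ∨
    ∀ p : T.Walk t t', p.IsPath → ∃ d ∈ p.darts, mConn M (τ ⁻¹' branch T d) < k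

/-- A linked matroid tree-decomposition. -/
def IsLinkedMDecomp {α : Type*} {n : ℕ} (M : Matroid α) (T : SimpleGraph (Fin n))
    (τ : α → Fin n) : Prop :=
  ∀ e f : T.Dart, dartLE T e f →
    sInf ((fun g => mConn M (τ ⁻¹' branch T g)) '' {g | dartLE T e g ∧ dartLE T g f}) =
      sInf (mConn M '' {X | τ ⁻¹' branch T e ⊆ X ∧ X ⊆ τ ⁻¹' branch T f})
/-- Two oriented separations are nested if they have `≤`-comparable orientations. -/
def Nested {V : Type*} (s t : OSep V) : Prop :=
  OSep.le s t ∨ OSep.le s t.flip ∨ OSep.le s.flip t ∨ OSep.le s.flip t.flip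

/-- The set of vertices that a path starting at `v` can only reach by traversing `u`. -/
def side {W : Type*} (T : SimpleGraph W) (u v : W) : Set W :=
  {w | ∀ p : T.Walk v w, p.IsPath → u ∈ p.support}

/-- `S` contains `u` but not `v`, and `uv` is the only edge of `T` leaving `S`. -/
structure IsEdgeCut {W : Type*} (T : SimpleGraph W) (u v : W) (S : Set W) : Prop where
  left_mem : u ∈ S
  right_notMem : v ∉ S
  eq_of_adj : ∀ a ∈ S, ∀ b ∉ S, T.Adj a b → a = u ∧ b = v

lemma IsEdgeCut.compl {W : Type*} {T : SimpleGraph W} {u v : W} {S : Set W}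
    (h : IsEdgeCut T u v S) : IsEdgeCut T v u Sᶜ where
  left_mem := h.right_notMem
  right_notMem := fun h' => h' h.left_mem
  eq_of_adj a ha b hb hab := (h.eq_of_adj b (not_not.1 hb) a ha hab.symm).symm

lemma isEdgeCut_side {W : Type*} {T : SimpleGraph W} (hT : T.IsTree) {u v : W}
    (huv : T.Adj u v) : IsEdgeCut T u v (side T u v) where
  left_mem := fun p _ => p.end_mem_support
  right_notMem := fun h => huv.ne (by simpa using h .nil .nil)
  eq_of_adj := by
    intro a ha b hb hab
    simp only [side, Set.mem_ofPred_eq, not_forall] at hb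
    obtain ⟨q, hq, huq⟩ := hb
    have haq : a ∉ q.support := fun haq =>
      huq (q.support_takeUntil_subset_support haq (ha _ (hq.takeUntil haq)))
    have hua : a = u := by
      have := ha (q.concat hab.symm) (hq.concat haq hab.symm)
      rw [SimpleGraph.Walk.support_concat] at this
      simpa [huq, eq_comm] using this
    subst hua
    have h := (hT.existsUnique_path a b).unique (hq.cons (h := huv) haq)
      (y₂ := .cons hab .nil) (by simp [hab.ne])
    have := congrArg SimpleGraph.Walk.snd h
    simp at this
    exact ⟨rfl, this.symm⟩

lemma IsEdgeCut.side_eq {W : Type*} {T : SimpleGraph W} (hT : T.Connected) {u v : W} {S : Set W}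
    (h : IsEdgeCut T u v S) : side T u v = S := by
  ext w
  constructor
  · intro hw
    by_contra hwS
    obtain ⟨p, hp⟩ := (hT v w).exists_isPath
    have hu := hw p hp
    obtain ⟨d, hd, hdS, hdS'⟩ := (p.dropUntil u hu).exists_boundary_dart S h.left_mem hwS
    have hdv := (h.eq_of_adj _ hdS _ hdS' d.adj).2
    have hv : v ∈ (p.dropUntil u hu).support.tail := by
      rw [← SimpleGraph.Walk.map_snd_darts]
      exact List.mem_map.2 ⟨d, hd, hdv⟩
    have hsp := congrArg SimpleGraph.Walk.support (p.take_spec hu)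
    have hnd := hp.support_nodup
    rw [← hsp, SimpleGraph.Walk.support_append, List.nodup_append] at hnd
    exact hnd.2.2 v (SimpleGraph.Walk.start_mem_support _) v hv rfl
  · intro hw p _
    obtain ⟨d, hd, hdS, hdS'⟩ := p.exists_boundary_dart Sᶜ h.right_notMem (not_not.2 hw)
    rw [← (h.compl.eq_of_adj _ hdS _ hdS' d.adj).2]
    exact p.dart_snd_mem_support_of_mem_darts hd

lemma side_compl {W : Type*} {T : SimpleGraph W} (hT : T.IsTree) {u v : W}
    (huv : T.Adj u v) : (side T u v)ᶜ = side T v u :=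
  ((isEdgeCut_side hT huv).compl.side_eq hT.connected).symm

lemma isTree_of_forall_isEdgeCut {W : Type*} {T : SimpleGraph W} (hT : T.Connected)
    (h : ∀ u v, T.Adj u v → ∃ S, IsEdgeCut T u v S) : T.IsTree := by
  refine ⟨hT, SimpleGraph.isAcyclic_iff_forall_adj_isBridge.2 fun u v huv => ?_⟩
  obtain ⟨S, hS⟩ := h u v huv
  rw [SimpleGraph.isBridge_iff_forall_walk_mem_edges]
  intro p
  obtain ⟨d, hd, hdS, hdS'⟩ := p.exists_boundary_dart S hS.left_mem hS.right_notMem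
  obtain ⟨h1, h2⟩ := hS.eq_of_adj _ hdS _ hdS' d.adj
  exact List.mem_map.2 ⟨d, hd, by rw [SimpleGraph.Dart.edge, ← h1, ← h2]⟩

lemma IsEdgeCut.mem_of_mem_darts {W : Type*} {T : SimpleGraph W} {a b : W} {p : T.Walk a b}
    (hp : p.IsPath) {d : T.Dart} (hd : d ∈ p.darts) {S : Set W}
    (h : IsEdgeCut T d.fst d.snd S) : a ∈ S ∧ b ∉ S := by
  induction p with
  | nil => simp at hd
  | @cons x y z hxy p ih =>
    rw [SimpleGraph.Walk.cons_isPath_iff] at hp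
    rw [SimpleGraph.Walk.darts_cons, List.mem_cons] at hd
    rcases hd with rfl | hd
    · refine ⟨h.left_mem, fun hb => hp.2 ?_⟩
      obtain ⟨e, he, heS, heS'⟩ := p.exists_boundary_dart Sᶜ h.right_notMem (not_not.2 hb)
      have := (h.compl.eq_of_adj _ heS _ heS' e.adj).2
      simp only at this
      rw [← this]
      exact p.dart_snd_mem_support_of_mem_darts he
    · obtain ⟨hy, hz⟩ := ih hp.1 hd
      refine ⟨by_contra fun hx => hp.2 ?_, hz⟩
      rw [(h.compl.eq_of_adj x hx y (not_not.2 hy) hxy).1]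
      exact p.dart_snd_mem_support_of_mem_darts hd

lemma exists_adj_mem_side {W : Type*} {T : SimpleGraph W} (hT : T.IsTree) {s w : W}
    (hsw : w ≠ s) : ∃ u, T.Adj s u ∧ w ∈ side T u s := by
  obtain ⟨p, hp⟩ := (hT.connected s w).exists_isPath
  cases p with
  | nil => exact absurd rfl hsw
  | @cons _ u _ h p =>
    refine ⟨u, h, ?_⟩
    rw [← side_compl hT h]
    exact (IsEdgeCut.mem_of_mem_darts hp (d := ⟨(s, u), h⟩) (by simp) (isEdgeCut_side hT h)).2

lemma side_disjoint_side {W : Type*} {T : SimpleGraph W} (hT : T.IsTree) {s u v : W}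
    (hu : T.Adj s u) (hv : T.Adj s v) (huv : u ≠ v) : Disjoint (side T u s) (side T v s) := by
  rw [Set.disjoint_left]
  intro w hwu hwv
  obtain ⟨p, hp⟩ := (hT.connected u w).exists_isPath
  have hvu : u ∉ side T v s := fun h =>
    huv ((isEdgeCut_side hT hv.symm).eq_of_adj u h s
      (isEdgeCut_side hT hv.symm).right_notMem hu.symm).1
  obtain ⟨d, hd, hdS, hdS'⟩ := p.exists_boundary_dart (side T v s)ᶜ hvu (not_not.2 hwv)
  have h1 := ((isEdgeCut_side hT hv.symm).compl.eq_of_adj _ hdS _ hdS' d.adj).1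
  have hs : s ∈ p.support := by
    rw [← h1]; exact p.dart_fst_mem_support_of_mem_darts hd
  rw [← side_compl hT hu] at hwu
  exact hwu fun q hq => by
    rwa [(hT.existsUnique_path u w).unique hq hp]

lemma self_notMem_side {W : Type*} (T : SimpleGraph W) {u v : W} (h : u ≠ v) : v ∉ side T u v :=
  fun h' => h (by simpa using h' .nil .nil)

lemma IsEdgeCut.notMem_side {W : Type*} {T : SimpleGraph W} {a b u v x : W} {B : Set W}
    (hB : IsEdgeCut T u v B) (hx : x ∉ side T a b) (hbx : ¬ (b ∈ B ↔ x ∈ B)) :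
    u ∉ side T a b ∧ v ∉ side T a b := by
  simp only [side, Set.mem_ofPred_eq, not_forall] at hx
  obtain ⟨q, hq, haq⟩ := hx
  have hout : ∀ y ∈ q.support, y ∉ side T a b := fun y hy h =>
    haq (q.support_takeUntil_subset_support hy (h _ (hq.takeUntil hy)))
  by_cases hb : b ∈ B
  · obtain ⟨d, hd, hdS, hdS'⟩ := q.exists_boundary_dart B hb (by tauto)
    obtain ⟨h1, h2⟩ := hB.eq_of_adj _ hdS _ hdS' d.adj
    exact ⟨hout u (h1 ▸ q.dart_fst_mem_support_of_mem_darts hd),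
      hout v (h2 ▸ q.dart_snd_mem_support_of_mem_darts hd)⟩
  · obtain ⟨d, hd, hdS, hdS'⟩ := q.exists_boundary_dart Bᶜ hb (by simp only [Set.mem_compl_iff]; tauto)
    obtain ⟨h1, h2⟩ := hB.compl.eq_of_adj _ hdS _ hdS' d.adj
    exact ⟨hout u (h2 ▸ q.dart_snd_mem_support_of_mem_darts hd),
      hout v (h1 ▸ q.dart_fst_mem_support_of_mem_darts hd)⟩

/-- Two sides of edges of a tree are nested. -/
lemma side_nested {W : Type*} {T : SimpleGraph W} (hT : T.IsTree) {a b u v : W}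
    (hab : T.Adj a b) (huv : T.Adj u v) :
    Disjoint (side T a b) (side T u v) ∨ side T a b ⊆ side T u v ∨
      side T u v ⊆ side T a b ∨ side T a b ∪ side T u v = Set.univ := by
  have hB := isEdgeCut_side hT huv
  have hba := side_compl hT hab
  by_cases h1 : ∀ x ∉ side T a b, (b ∈ side T u v ↔ x ∈ side T u v)
  · by_cases hb : b ∈ side T u v
    · right; right; right
      rw [Set.eq_univ_iff_forall]
      intro x
      by_cases hx : x ∈ side T a b
      · exact .inl hx
      · exact .inr ((h1 x hx).1 hb)
    · right; right; left
      intro x hx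
      by_contra hx'
      exact hb ((h1 x hx').2 hx)
  · push Not at h1
    obtain ⟨x, hx, hbx⟩ := h1
    have hu := (hB.notMem_side hx (by tauto)).1
    have h2 : ∀ y ∈ side T a b, (a ∈ side T u v ↔ y ∈ side T u v) := by
      intro y hy
      by_contra hay
      refine (hB.notMem_side (a := b) (b := a) (x := y) ?_ hay).1 ?_
      · rw [← hba]; exact not_not.2 hy
      · rw [← hba]; exact hu
    by_cases ha : a ∈ side T u v
    · exact .inr (.inl fun y hy => (h2 y hy).1 ha)
    · exact .inl (Set.disjoint_left.2 fun y hy hy' => ha ((h2 y hy).2 hy'))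

/-- Two copies of `T`, joined by an edge from `a` in the first copy to `b` in the second. -/
def doubleTree {W : Type*} (T : SimpleGraph W) (a b : W) : SimpleGraph (W ⊕ W) :=
  (T ⊕g T) ⊔ SimpleGraph.edge (Sum.inl a) (Sum.inr b)

section doubleTree
variable {W : Type*} {T : SimpleGraph W} {a b u v : W}

@[simp] lemma doubleTree_adj_inl_inl : (doubleTree T a b).Adj (.inl u) (.inl v) ↔ T.Adj u v := by
  simp [doubleTree, SimpleGraph.edge_adj]

@[simp] lemma doubleTree_adj_inr_inr : (doubleTree T a b).Adj (.inr u) (.inr v) ↔ T.Adj u v := by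
  simp [doubleTree, SimpleGraph.edge_adj]

@[simp] lemma doubleTree_adj_inl_inr :
    (doubleTree T a b).Adj (.inl u) (.inr v) ↔ u = a ∧ v = b := by
  simp [doubleTree, SimpleGraph.edge_adj]

@[simp] lemma doubleTree_adj_inr_inl :
    (doubleTree T a b).Adj (.inr u) (.inl v) ↔ v = a ∧ u = b := by
  rw [SimpleGraph.adj_comm, doubleTree_adj_inl_inr]

lemma isEdgeCut_doubleTree_inl (hT : T.IsTree) (huv : T.Adj u v) :
    IsEdgeCut (doubleTree T a b) (.inl u) (.inl v)
      {x | Sum.elim (· ∈ side T u v) (fun _ => a ∈ side T u v) x} where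
  left_mem := (isEdgeCut_side hT huv).left_mem
  right_notMem := (isEdgeCut_side hT huv).right_notMem
  eq_of_adj := by
    have := (isEdgeCut_side hT huv).eq_of_adj
    rintro (x | x) hx (y | y) hy hxy <;> simp at hx hy hxy ⊢
    · exact this x hx y hy hxy
    · exact hy (hxy.1 ▸ hx)
    · exact hy (hxy.1 ▸ hx)
    · exact hy hx

lemma isEdgeCut_doubleTree_inr (hT : T.IsTree) (huv : T.Adj u v) :
    IsEdgeCut (doubleTree T a b) (.inr u) (.inr v)
      {x | Sum.elim (fun _ => b ∈ side T u v) (· ∈ side T u v) x} where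
  left_mem := (isEdgeCut_side hT huv).left_mem
  right_notMem := (isEdgeCut_side hT huv).right_notMem
  eq_of_adj := by
    have := (isEdgeCut_side hT huv).eq_of_adj
    rintro (x | x) hx (y | y) hy hxy <;> simp at hx hy hxy ⊢
    · exact hy hx
    · exact hy (hxy.2 ▸ hx)
    · exact hy (hxy.2 ▸ hx)
    · exact this x hx y hy hxy

lemma isEdgeCut_doubleTree_inl_inr :
    IsEdgeCut (doubleTree T a b) (.inl a) (.inr b) {x | x.isLeft} where
  left_mem := rfl
  right_notMem := by simp
  eq_of_adj := by
    rintro (x | x) hx (y | y) hy hxy <;> simp at hx hy hxy ⊢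
    exact hxy

lemma doubleTree_isTree (hT : T.IsTree) (a b : W) : (doubleTree T a b).IsTree := by
  refine isTree_of_forall_isEdgeCut (hT.connected.sum_sup_edge hT.connected) ?_
  rintro (u | u) (v | v) huv <;> simp at huv
  · exact ⟨_, isEdgeCut_doubleTree_inl hT huv⟩
  · obtain ⟨rfl, rfl⟩ := huv
    exact ⟨_, isEdgeCut_doubleTree_inl_inr⟩
  · obtain ⟨rfl, rfl⟩ := huv
    exact ⟨_, isEdgeCut_doubleTree_inl_inr.compl⟩
  · exact ⟨_, isEdgeCut_doubleTree_inr hT huv⟩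

end doubleTree

/-- A normalised, monotone and submodular integer-valued set function. -/
structure IsPolymatroid {α : Type*} (r : Set α → ℤ) : Prop where
  empty : r ∅ = 0
  mono : ∀ {X Y : Set α}, X ⊆ Y → r X ≤ r Y
  submod : ∀ X Y : Set α, r (X ∪ Y) + r (X ∩ Y) ≤ r X + r Y

/-- The connectivity function of `r`. -/
def conn {α : Type*} (r : Set α → ℤ) (X : Set α) : ℤ := r X + r Xᶜ - r Set.univ

/-- The amount by which the rank drops when `X` is removed from the ground set. -/
def defect {α : Type*} (r : Set α → ℤ) (X : Set α) : ℤ := r Set.univ - r Xᶜ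

/-- The integer-valued width of the bag at `v`. -/
def bagWidth {α W : Type*} [Fintype W] (r : Set α → ℤ) (T : SimpleGraph W) (τ : α → W) (v : W) :
    ℤ :=
  r Set.univ - ∑ u, if T.Adj v u then defect r (τ ⁻¹' side T u v) else 0

/-- The width at `s` after moving all elements outside `X` to a new branch attached at `a`. -/
def cutWidth {α W : Type*} [Fintype W] (r : Set α → ℤ) (T : SimpleGraph W) (τ : α → W)
    (a : W) (X : Set α) (s : W) : ℤ :=
  r Set.univ - (∑ u, if T.Adj s u then
      defect r (if a ∈ side T u s then τ ⁻¹' side T u s ∪ Xᶜ else τ ⁻¹' side T u s ∩ X) else 0)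
    - if s = a then defect r Xᶜ else 0

section width
variable {α W : Type*} {r : Set α → ℤ}

lemma conn_compl (r : Set α → ℤ) (X : Set α) : conn r Xᶜ = conn r X := by
  simp only [conn, compl_compl]; ring

lemma IsPolymatroid.nonneg (hr : IsPolymatroid r) (X : Set α) : 0 ≤ r X :=
  hr.empty ▸ hr.mono (Set.empty_subset X)

lemma IsPolymatroid.conn_nonneg (hr : IsPolymatroid r) (X : Set α) : 0 ≤ conn r X := by
  have := hr.submod X Xᶜ
  simp only [Set.union_compl_self, Set.inter_compl_self, hr.empty] at this
  simp only [conn]; omega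

lemma IsPolymatroid.defect_nonneg (hr : IsPolymatroid r) (X : Set α) : 0 ≤ defect r X := by
  have := hr.mono (Set.subset_univ Xᶜ)
  simp only [defect]; omega

lemma IsPolymatroid.sum_defect_sub_le (hr : IsPolymatroid r) {ι : Type*} (I : Finset ι)
    (B : ι → Set α) (C X : Set α) (hB : (I : Set ι).PairwiseDisjoint B)
    (hC : ∀ i ∈ I, Disjoint (B i) C) :
    ∑ i ∈ I, (defect r (B i) - defect r (B i ∩ X)) ≤ r Xᶜ - r (Xᶜ ∩ C) := by
  suffices h : ∑ i ∈ I, (defect r (B i) - defect r (B i ∩ X)) ≤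
      r (Xᶜ ∩ (C ∪ ⋃ i ∈ I, B i)) - r (Xᶜ ∩ C) by
    have := hr.mono (X := Xᶜ ∩ (C ∪ ⋃ i ∈ I, B i)) (Y := Xᶜ) Set.inter_subset_left
    omega
  induction I using Finset.induction_on with
  | empty => simp
  | insert j I hj ih =>
    have ih' := ih (hB.subset (by simp)) fun i hi => hC i (Finset.mem_insert_of_mem hi)
    rw [Finset.sum_insert hj]
    have hsub := hr.submod (B j)ᶜ (Xᶜ ∩ (C ∪ ⋃ i ∈ insert j I, B i))
    have h1 : (B j)ᶜ ∪ (Xᶜ ∩ (C ∪ ⋃ i ∈ insert j I, B i)) = (B j ∩ X)ᶜ := by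
      ext x
      simp only [Finset.set_biUnion_insert, Set.mem_union, Set.mem_compl_iff, Set.mem_inter_iff]
      tauto
    have h2 : (B j)ᶜ ∩ (Xᶜ ∩ (C ∪ ⋃ i ∈ insert j I, B i)) = Xᶜ ∩ (C ∪ ⋃ i ∈ I, B i) := by
      have h3 : ∀ x ∈ C ∪ ⋃ i ∈ I, B i, x ∉ B j := by
        rintro x (hx | hx) hxj
        · exact Set.disjoint_left.1 (hC j (Finset.mem_insert_self _ _)) hxj hx
        · obtain ⟨i, hi, hxi⟩ := Set.mem_iUnion₂.1 hx
          exact Set.disjoint_left.1 (hB (by simp) (by simp [hi]) (by rintro rfl; exact hj hi))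
            hxj hxi
      ext x
      have := h3 x
      simp only [Finset.set_biUnion_insert, Set.mem_union, Set.mem_compl_iff, Set.mem_inter_iff]
        at this ⊢
      tauto
    rw [h1, h2] at hsub
    simp only [defect] at ih' ⊢
    omega

lemma pairwiseDisjoint_side {T : SimpleGraph W} (hT : T.IsTree) (τ : α → W) (s : W) :
    ({u | T.Adj s u} : Set W).PairwiseDisjoint fun u => τ ⁻¹' side T u s :=
  fun _ hu _ hv huv => (side_disjoint_side hT hu hv huv).preimage τ

variable [Fintype W] {T : SimpleGraph W} {τ : α → W} {a b s u : W} {X Z : Set α}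

lemma bagWidth_eq (r : Set α → ℤ) (T : SimpleGraph W) (τ : α → W) (s : W) :
    bagWidth r T τ s =
      r Set.univ - ∑ u ∈ Finset.univ.filter (T.Adj s), defect r (τ ⁻¹' side T u s) := by
  rw [bagWidth, Finset.sum_filter]

lemma bagWidth_eq_erase (r : Set α → ℤ) (τ : α → W) (hsu : T.Adj s u) :
    bagWidth r T τ s = r Set.univ - defect r (τ ⁻¹' side T u s) -
      ∑ u ∈ (Finset.univ.filter (T.Adj s)).erase u, defect r (τ ⁻¹' side T u s) := by
  rw [bagWidth_eq, ← Finset.add_sum_erase _ _ (show u ∈ Finset.univ.filter (T.Adj s) by simpa)]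
  ring

lemma IsPolymatroid.le_bagWidth (hr : IsPolymatroid r) (hT : T.IsTree) (hZ : Z ⊆ τ ⁻¹' {s}) :
    r Z ≤ bagWidth r T τ s := by
  have h := hr.sum_defect_sub_le (Finset.univ.filter (T.Adj s)) (fun u => τ ⁻¹' side T u s)
    Z ∅ ((pairwiseDisjoint_side hT τ s).subset (by simp)) (by
      intro u hu
      rw [Set.disjoint_left]
      intro x hx hxZ
      have hxs : τ x = s := hZ hxZ
      have hus : T.Adj s u := by simpa using hu
      rw [Set.mem_preimage, hxs] at hx
      exact self_notMem_side T hus.ne' hx)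
  simp only [Set.inter_empty, Set.compl_empty, Set.univ_inter, Finset.sum_sub_distrib] at h
  rw [bagWidth_eq]
  simp [defect] at h ⊢
  omega

lemma IsPolymatroid.bagWidth_nonneg (hr : IsPolymatroid r) (hT : T.IsTree) (τ : α → W) (s : W) :
    0 ≤ bagWidth r T τ s :=
  (hr.nonneg _).trans (hr.le_bagWidth hT subset_rfl)

lemma IsPolymatroid.conn_le_bagWidth (hr : IsPolymatroid r) (hT : T.IsTree) (τ : α → W)
    (hsu : T.Adj s u) : conn r (τ ⁻¹' side T u s) ≤ bagWidth r T τ s := by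
  have h := hr.sum_defect_sub_le ((Finset.univ.filter (T.Adj s)).erase u)
    (fun u => τ ⁻¹' side T u s) (τ ⁻¹' side T u s) ∅
    ((pairwiseDisjoint_side hT τ s).subset (by intro; simp; tauto)) (by
      intro v hv
      exact pairwiseDisjoint_side hT τ s (by simp at hv; exact hv.2) hsu (Finset.ne_of_mem_erase hv))
  simp only [Set.inter_empty, Set.compl_empty, Set.univ_inter, Finset.sum_sub_distrib] at h
  rw [bagWidth_eq_erase r τ hsu]
  simp [defect, conn] at h ⊢
  omega

lemma IsPolymatroid.cutWidth_self_lt (hr : IsPolymatroid r) (hT : T.IsTree)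
    (hZ : Z ⊆ τ ⁻¹' {a}) (hZX : Z ⊆ Xᶜ) (hX : conn r X < r Z) :
    cutWidth r T τ a X a < bagWidth r T τ a := by
  have h := hr.sum_defect_sub_le (Finset.univ.filter (T.Adj a)) (fun u => τ ⁻¹' side T u a)
    Z X ((pairwiseDisjoint_side hT τ a).subset (by simp)) (by
      intro u hu
      rw [Set.disjoint_left]
      intro x hx hxZ
      have hxs : τ x = a := hZ hxZ
      have hus : T.Adj a u := by simpa using hu
      rw [Set.mem_preimage, hxs] at hx
      exact self_notMem_side T hus.ne' hx)
  rw [Set.inter_eq_right.2 hZX, Finset.sum_sub_distrib] at h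
  have h2 : cutWidth r T τ a X a = r X -
      ∑ u ∈ Finset.univ.filter (T.Adj a), defect r (τ ⁻¹' side T u a ∩ X) := by
    rw [cutWidth, Finset.sum_filter, if_pos rfl]
    have : ∀ u, (if T.Adj a u then defect r (if a ∈ side T u a then τ ⁻¹' side T u a ∪ Xᶜ
        else τ ⁻¹' side T u a ∩ X) else 0) =
        if T.Adj a u then defect r (τ ⁻¹' side T u a ∩ X) else 0 := by
      intro u
      by_cases hu : T.Adj a u
      · rw [if_pos hu, if_pos hu, if_neg (self_notMem_side T hu.ne')]
      · rw [if_neg hu, if_neg hu]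
    rw [Finset.sum_congr rfl fun u _ => this u]
    simp only [defect, compl_compl]
    ring
  rw [h2, bagWidth_eq]
  simp only [conn] at hX
  omega

lemma cutWidth_eq_erase (r : Set α → ℤ) (τ : α → W) (X : Set α) (hT : T.IsTree)
    (hsu : T.Adj s u) (ha : a ∈ side T u s) :
    cutWidth r T τ a X s = r Set.univ - defect r (τ ⁻¹' side T u s ∪ Xᶜ) -
      ∑ v ∈ (Finset.univ.filter (T.Adj s)).erase u, defect r (τ ⁻¹' side T v s ∩ X) := by
  have hsa : s ≠ a := by
    rintro rfl
    exact self_notMem_side T hsu.ne' ha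
  rw [cutWidth, if_neg hsa, ← Finset.sum_filter,
    ← Finset.add_sum_erase _ _ (show u ∈ Finset.univ.filter (T.Adj s) by simpa), if_pos ha,
    Finset.sum_congr rfl (g := fun v => defect r (τ ⁻¹' side T v s ∩ X))]
  · ring
  · intro v hv
    have hv' : v ≠ u ∧ T.Adj s v := by simpa using hv
    rw [if_neg]
    exact fun h => Set.disjoint_left.1 (side_disjoint_side hT hv'.2 hsu hv'.1) h ha

lemma IsPolymatroid.cutWidth_add_conn_le (hr : IsPolymatroid r) (hT : T.IsTree) (τ : α → W)
    (X : Set α) (hsu : T.Adj s u) (ha : a ∈ side T u s) :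
    cutWidth r T τ a X s + conn r ((τ ⁻¹' side T u s)ᶜ ∪ X) ≤ bagWidth r T τ s + conn r X := by
  have h := hr.sum_defect_sub_le ((Finset.univ.filter (T.Adj s)).erase u)
    (fun u => τ ⁻¹' side T u s) (τ ⁻¹' side T u s) X
    ((pairwiseDisjoint_side hT τ s).subset (by intro; simp; tauto)) (by
      intro v hv
      exact pairwiseDisjoint_side hT τ s (by simp at hv; exact hv.2) hsu (Finset.ne_of_mem_erase hv))
  rw [cutWidth_eq_erase r τ X hT hsu ha, bagWidth_eq_erase r τ hsu]
  have h2 := hr.submod (τ ⁻¹' side T u s)ᶜ X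
  rw [Finset.sum_sub_distrib] at h
  simp only [conn, defect, Set.compl_union, compl_compl] at h h2 ⊢
  rw [Set.inter_comm Xᶜ] at h
  omega

lemma IsPolymatroid.cutWidth_nonpos (hr : IsPolymatroid r) (hT : T.IsTree)
    (hsu : T.Adj s u) (ha : a ∈ side T u s) (hX : (τ ⁻¹' side T u s)ᶜ ⊆ Xᶜ) :
    cutWidth r T τ a X s ≤ 0 := by
  rw [cutWidth_eq_erase r τ X hT hsu ha]
  have h1 : τ ⁻¹' side T u s ∪ Xᶜ = Set.univ := by
    rw [Set.eq_univ_iff_forall]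
    intro x
    by_cases hx : x ∈ τ ⁻¹' side T u s
    · exact .inl hx
    · exact .inr (hX hx)
  have h2 : 0 ≤ ∑ v ∈ (Finset.univ.filter (T.Adj s)).erase u, defect r (τ ⁻¹' side T v s ∩ X) :=
    Finset.sum_nonneg fun v _ => hr.defect_nonneg _
  rw [h1]
  simp only [defect, Set.compl_univ, hr.empty] at h2 ⊢
  omega

lemma IsPolymatroid.cutWidth_compl_le_conn (hr : IsPolymatroid r) (hT : T.IsTree)
    (hsu : T.Adj s u) (hX : (τ ⁻¹' side T u s)ᶜ ⊆ X) (b : W) :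
    cutWidth r T τ b Xᶜ s ≤ conn r X := by
  by_cases hbu : b ∈ side T u s
  · exact (hr.cutWidth_nonpos hT hsu hbu (by rwa [compl_compl])).trans (hr.conn_nonneg X)
  have hXu : Xᶜ ⊆ τ ⁻¹' side T u s := Set.compl_subset_comm.1 hX
  by_cases hsb : s = b
  · subst hsb
    rw [cutWidth, if_pos rfl, compl_compl, ← Finset.sum_filter,
      ← Finset.add_sum_erase _ _ (show u ∈ Finset.univ.filter (T.Adj s) by simpa), if_neg hbu,
      Set.inter_eq_right.2 hXu]
    have h2 : 0 ≤ ∑ v ∈ (Finset.univ.filter (T.Adj s)).erase u,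
        defect r (if s ∈ side T v s then τ ⁻¹' side T v s ∪ X else τ ⁻¹' side T v s ∩ Xᶜ) :=
      Finset.sum_nonneg fun v _ => hr.defect_nonneg _
    simp only [conn, defect, compl_compl] at h2 ⊢
    omega
  · obtain ⟨v, hsv, hbv⟩ := exists_adj_mem_side hT (Ne.symm hsb)
    have huv : u ≠ v := by rintro rfl; exact hbu hbv
    rw [cutWidth_eq_erase r τ Xᶜ hT hsv hbv, compl_compl,
      ← Finset.add_sum_erase _ _ (show u ∈ (Finset.univ.filter (T.Adj s)).erase v by simp [*]),
      Set.inter_eq_right.2 hXu]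
    have h1 : τ ⁻¹' side T v s ∪ X = X := by
      refine Set.union_eq_right.2 (Set.Subset.trans ?_ hX)
      exact Set.disjoint_left.1 (pairwiseDisjoint_side hT τ s hsv hsu huv.symm)
    have h2 : 0 ≤ ∑ v ∈ ((Finset.univ.filter (T.Adj s)).erase v).erase u,
        defect r (τ ⁻¹' side T v s ∩ Xᶜ) :=
      Finset.sum_nonneg fun v _ => hr.defect_nonneg _
    rw [h1]
    simp only [conn, defect, compl_compl] at h2 ⊢
    omega

end width

/-- Elements in `X` stay in the first copy of the tree, the others move to the second copy. -/
def splitMap {α W : Type*} (τ : α → W) (X : Set α) (x : α) : W ⊕ W :=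
  if x ∈ X then .inl (τ x) else .inr (τ x)

section double
variable {α W : Type*} {T : SimpleGraph W} {τ : α → W} {a b s u : W} {X : Set α}

lemma preimage_side_inl (hT : T.IsTree) (hus : T.Adj u s) :
    splitMap τ X ⁻¹' side (doubleTree T a b) (.inl u) (.inl s) =
      if a ∈ side T u s then τ ⁻¹' side T u s ∪ Xᶜ else τ ⁻¹' side T u s ∩ X := by
  rw [(isEdgeCut_doubleTree_inl hT hus).side_eq (doubleTree_isTree hT a b).connected]
  ext x
  by_cases hx : x ∈ X <;> by_cases ha : a ∈ side T u s <;> simp [splitMap, hx, ha]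

lemma preimage_side_inr (hT : T.IsTree) (hus : T.Adj u s) :
    splitMap τ X ⁻¹' side (doubleTree T a b) (.inr u) (.inr s) =
      if b ∈ side T u s then τ ⁻¹' side T u s ∪ X else τ ⁻¹' side T u s ∩ Xᶜ := by
  rw [(isEdgeCut_doubleTree_inr hT hus).side_eq (doubleTree_isTree hT a b).connected]
  ext x
  by_cases hx : x ∈ X <;> by_cases ha : b ∈ side T u s <;> simp [splitMap, hx, ha]

lemma preimage_side_inl_inr (hT : T.IsTree) :
    splitMap τ X ⁻¹' side (doubleTree T a b) (.inl a) (.inr b) = X := by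
  rw [isEdgeCut_doubleTree_inl_inr.side_eq (doubleTree_isTree hT a b).connected]
  ext x
  by_cases hx : x ∈ X <;> simp [splitMap, hx]

lemma preimage_side_inr_inl (hT : T.IsTree) :
    splitMap τ X ⁻¹' side (doubleTree T a b) (.inr b) (.inl a) = Xᶜ := by
  rw [← side_compl (doubleTree_isTree hT a b) (by simp), Set.preimage_compl,
    preimage_side_inl_inr hT]

variable [Fintype W]

lemma bagWidth_doubleTree_inl (r : Set α → ℤ) (τ : α → W) (X : Set α) (hT : T.IsTree)
    (a b s : W) :
    bagWidth r (doubleTree T a b) (splitMap τ X) (.inl s) = cutWidth r T τ a X s := by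
  rw [bagWidth, cutWidth, Fintype.sum_sum_type, sub_sub]
  congr 2
  · refine Finset.sum_congr rfl fun u _ => ?_
    by_cases hu : T.Adj s u
    · rw [if_pos hu, if_pos (by simpa), preimage_side_inl hT hu.symm]
    · rw [if_neg hu, if_neg (by simpa)]
  · by_cases hs : s = a
    · subst hs
      rw [Finset.sum_eq_single b]
      · simp [preimage_side_inr_inl hT]
      · intro u _ hu
        simp [hu]
      · simp
    · simp [hs]

lemma bagWidth_doubleTree_inr (r : Set α → ℤ) (τ : α → W) (X : Set α) (hT : T.IsTree)
    (a b s : W) :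
    bagWidth r (doubleTree T a b) (splitMap τ X) (.inr s) = cutWidth r T τ b Xᶜ s := by
  rw [bagWidth, cutWidth, Fintype.sum_sum_type, sub_sub, add_comm, compl_compl]
  congr 2
  · refine Finset.sum_congr rfl fun u _ => ?_
    by_cases hu : T.Adj s u
    · rw [if_pos hu, if_pos (by simpa), preimage_side_inr hT hu.symm]
    · rw [if_neg hu, if_neg (by simpa)]
  · by_cases hs : s = b
    · subst hs
      rw [Finset.sum_eq_single a]
      · simp [preimage_side_inl_inr hT]
      · intro u _ hu
        simp [hu]
      · simp
    · simp [hs]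

end double

/-- `X` has minimal connectivity among its unions with the sides of tree edges avoiding `a`, and
it is nested with those sides for which equality holds. -/
def Uncrossed {α W : Type*} (r : Set α → ℤ) (T : SimpleGraph W) (τ : α → W) (a : W)
    (X : Set α) : Prop :=
  ∀ s u, T.Adj s u → a ∈ side T u s →
    conn r X ≤ conn r ((τ ⁻¹' side T u s)ᶜ ∪ X) ∧
    (conn r ((τ ⁻¹' side T u s)ᶜ ∪ X) = conn r X →
      (τ ⁻¹' side T u s)ᶜ ⊆ X ∨ (τ ⁻¹' side T u s)ᶜ ⊆ Xᶜ)

/-- The number of sides of tree edges contained in `X` or in its complement. -/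
def unsplitCount {α W : Type*} [Fintype W] (T : SimpleGraph W) (τ : α → W) (X : Set α) : ℕ :=
  (Finset.univ.filter fun p : W × W => T.Adj p.1 p.2 ∧
    (τ ⁻¹' side T p.1 p.2 ⊆ X ∨ τ ⁻¹' side T p.1 p.2 ⊆ Xᶜ)).card

section uncross
variable {α W : Type*} [Fintype W] {r : Set α → ℤ} {T : SimpleGraph W} {τ : α → W} {a b : W}
  {X Z₁ Z₂ : Set α} {k : ℤ}

lemma unsplitCount_compl (T : SimpleGraph W) (τ : α → W) (X : Set α) :
    unsplitCount T τ Xᶜ = unsplitCount T τ X := by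
  simp only [unsplitCount, compl_compl, or_comm]

lemma uncrossed_of_optimal (hT : T.IsTree) (hZ₁ : Z₁ ⊆ τ ⁻¹' {b}) (hZ₂ : Z₂ ⊆ τ ⁻¹' {a})
    (hne : Z₁.Nonempty) (hZX₁ : Z₁ ⊆ X) (hZX₂ : X ⊆ Z₂ᶜ) (hX : conn r X < k)
    (hk : ∀ s u, T.Adj s u → a ∈ side T u s → b ∉ side T u s → k ≤ conn r (τ ⁻¹' side T u s))
    (hmin : ∀ X', Z₁ ⊆ X' → X' ⊆ Z₂ᶜ → conn r X ≤ conn r X')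
    (hmax : ∀ X', Z₁ ⊆ X' → X' ⊆ Z₂ᶜ → conn r X' = conn r X →
      unsplitCount T τ X' ≤ unsplitCount T τ X) :
    Uncrossed r T τ a X := by
  intro s u hsu ha
  have hc := side_compl hT hsu
  have hZ₂u : Z₂ ⊆ τ ⁻¹' side T u s := fun x hx => by
    have : τ x = a := hZ₂ hx
    rwa [Set.mem_preimage, this]
  have h₁ : Z₁ ⊆ (τ ⁻¹' side T u s)ᶜ ∪ X := hZX₁.trans Set.subset_union_right
  have h₂ : (τ ⁻¹' side T u s)ᶜ ∪ X ⊆ Z₂ᶜ :=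
    Set.union_subset (Set.compl_subset_compl.2 hZ₂u) hZX₂
  refine ⟨hmin _ h₁ h₂, fun heq => ?_⟩
  by_contra! hcon
  refine (hmax _ h₁ h₂ heq).not_gt (Finset.card_lt_card (Finset.ssubset_iff_of_subset ?_ |>.2 ?_))
  · rintro ⟨v, w⟩ h
    simp only [Finset.mem_filter, Finset.mem_univ, true_and] at h ⊢
    refine ⟨h.1, ?_⟩
    rcases h.2 with h' | h'
    · exact .inl (h'.trans Set.subset_union_right)
    have hG : (τ ⁻¹' side T u s)ᶜ = τ ⁻¹' side T s u := by
      rw [← Set.preimage_compl, side_compl hT hsu.symm]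
    rw [hG] at hcon heq ⊢
    rcases side_nested hT hsu h.1 with hn | hn | hn | hn
    · right
      rw [Set.compl_union]
      exact Set.subset_inter (Set.disjoint_right.1 (hn.preimage τ)) h'
    · exact absurd ((Set.preimage_mono hn).trans h') hcon.2
    · exact .inl ((Set.preimage_mono hn).trans Set.subset_union_left)
    · exfalso
      have hXG : X ⊆ τ ⁻¹' side T s u := by
        intro x hx
        have hx' : τ x ∈ side T s u ∪ side T v w := hn ▸ Set.mem_univ _
        exact hx'.resolve_right fun hxv => h' hxv hx
      rw [Set.union_eq_left.2 hXG] at heq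
      obtain ⟨z, hz⟩ := hne
      have hzb : τ z = b := hZ₁ hz
      have hb : b ∈ side T s u := hzb ▸ hXG (hZX₁ hz)
      rw [← side_compl hT hsu.symm] at hb
      have := hk s u hsu ha hb
      rw [← conn_compl, hG, heq] at this
      omega
  · have hG : (τ ⁻¹' side T u s)ᶜ = τ ⁻¹' side T s u := by
      rw [← Set.preimage_compl, side_compl hT hsu.symm]
    rw [hG] at hcon ⊢
    refine ⟨(s, u), ?_, ?_⟩
    · simp [hsu]
    · simp [hsu, hcon]

lemma exists_uncrossed [Finite α] (hT : T.IsTree) (hZ₁ : Z₁ ⊆ τ ⁻¹' {b}) (hZ₂ : Z₂ ⊆ τ ⁻¹' {a})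
    (hne₁ : Z₁.Nonempty) (hne₂ : Z₂.Nonempty)
    (hex : ∃ X, Z₁ ⊆ X ∧ X ⊆ Z₂ᶜ ∧ conn r X < k)
    (hk : ∀ s u, T.Adj s u → a ∈ side T u s → b ∉ side T u s → k ≤ conn r (τ ⁻¹' side T u s)) :
    ∃ X, Z₁ ⊆ X ∧ X ⊆ Z₂ᶜ ∧ conn r X < k ∧ Uncrossed r T τ a X ∧ Uncrossed r T τ b Xᶜ := by
  obtain ⟨X₀, h₁, h₂, hX₀⟩ := hex
  obtain ⟨X₁, hX₁, hmin⟩ := Set.exists_min_image {X | Z₁ ⊆ X ∧ X ⊆ Z₂ᶜ} (conn r)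
    (Set.toFinite _) ⟨X₀, h₁, h₂⟩
  obtain ⟨X, ⟨hX, hXeq⟩, hmax⟩ := Set.exists_max_image
    {X | (Z₁ ⊆ X ∧ X ⊆ Z₂ᶜ) ∧ conn r X = conn r X₁} (unsplitCount T τ)
    (Set.toFinite _) ⟨X₁, hX₁, rfl⟩
  have hlt : conn r X < k := hXeq ▸ (hmin X₀ ⟨h₁, h₂⟩).trans_lt hX₀
  refine ⟨X, hX.1, hX.2, hlt, ?_, ?_⟩
  · refine uncrossed_of_optimal hT hZ₁ hZ₂ hne₁ hX.1 hX.2 hlt hk ?_ ?_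
    · exact fun X' h h' => hXeq ▸ hmin X' ⟨h, h'⟩
    · exact fun X' h h' he => hmax X' ⟨⟨h, h'⟩, he.trans hXeq⟩
  · refine uncrossed_of_optimal hT hZ₂ hZ₁ hne₂ (Set.subset_compl_comm.1 hX.2)
      (Set.compl_subset_compl.2 hX.1) (by rwa [conn_compl]) ?_ ?_ ?_
    · intro s u hsu hb ha
      rw [← conn_compl, ← Set.preimage_compl, side_compl hT hsu.symm]
      rw [← side_compl hT hsu] at hb ha
      exact hk u s hsu.symm (not_not.1 ha) hb
    · intro X' h h'
      rw [conn_compl, ← conn_compl r X', hXeq]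
      exact hmin X'ᶜ ⟨Set.subset_compl_comm.1 h', Set.compl_subset_compl.2 h⟩
    · intro X' h h' he
      rw [conn_compl] at he
      rw [unsplitCount_compl, ← unsplitCount_compl T τ X']
      exact hmax X'ᶜ ⟨⟨Set.subset_compl_comm.1 h', Set.compl_subset_compl.2 h⟩,
        by rw [conn_compl, he, hXeq]⟩

lemma Uncrossed.cutWidth_le (h : Uncrossed r T τ a X) (hr : IsPolymatroid r) (hT : T.IsTree)
    (hZ : Z₂ ⊆ τ ⁻¹' {a}) (hZX : Z₂ ⊆ Xᶜ) (hX : conn r X < r Z₂) (s : W) :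
    cutWidth r T τ a X s ≤ bagWidth r T τ s := by
  by_cases hs : s = a
  · exact hs ▸ (hr.cutWidth_self_lt hT hZ hZX hX).le
  · obtain ⟨u, hsu, ha⟩ := exists_adj_mem_side hT (Ne.symm hs)
    have := hr.cutWidth_add_conn_le hT τ X hsu ha
    have := (h s u hsu ha).1
    omega

lemma Uncrossed.exists_adj_of_cutWidth_eq (h : Uncrossed r T τ a X) (hr : IsPolymatroid r)
    (hT : T.IsTree) (hZ : Z₂ ⊆ τ ⁻¹' {a}) (hZX : Z₂ ⊆ Xᶜ) (hX : conn r X < r Z₂) {s : W}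
    (heq : cutWidth r T τ a X s = bagWidth r T τ s) (hpos : 0 < bagWidth r T τ s) :
    ∃ u, T.Adj s u ∧ a ∈ side T u s ∧ (τ ⁻¹' side T u s)ᶜ ⊆ X := by
  have hs : s ≠ a := by
    rintro rfl
    exact (hr.cutWidth_self_lt hT hZ hZX hX).ne heq
  obtain ⟨u, hsu, ha⟩ := exists_adj_mem_side hT (Ne.symm hs)
  refine ⟨u, hsu, ha, ?_⟩
  have h1 := hr.cutWidth_add_conn_le hT τ X hsu ha
  obtain ⟨h2, h3⟩ := h s u hsu ha
  refine (h3 (by omega)).resolve_right fun h4 => ?_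
  have := hr.cutWidth_nonpos hT hsu ha h4
  omega

end uncross

lemma isDershowitzMannaLT_map_add_map {W : Type*} [Fintype W] (w w₁ w₂ : W → ℕ) (k : ℕ)
    (h₁ : ∀ s, w₁ s ≤ w s) (h₂ : ∀ s, w₂ s ≤ w s)
    (h₁₂ : ∀ s, k ≤ w s → w₁ s = w s → w₂ s < k) (h₂₁ : ∀ s, k ≤ w s → w₂ s = w s → w₁ s < k)
    (h : ∃ s, k ≤ w s ∧ w₁ s < w s ∧ w₂ s < w s) :
    Multiset.IsDershowitzMannaLT (Finset.univ.val.map w₁ + Finset.univ.val.map w₂)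
      (Finset.univ.val.map w) := by
  obtain ⟨s₀, hs₀, hs₁, hs₂⟩ := h
  let keep : W → Prop := fun s => k ≤ w s ∧ (w₁ s = w s ∨ w₂ s = w s)
  have hsplit : ∀ m : Multiset W, m.map w₁ + m.map w₂ = (m.filter keep).map w +
      ((m.filter keep).map (fun s => min (w₁ s) (w₂ s)) +
        ((m.filter (¬ keep ·)).map w₁ + (m.filter (¬ keep ·)).map w₂)) := by
    intro m
    induction m using Multiset.induction_on with
    | empty => simp
    | cons s m ih =>
      by_cases hs : keep s
      · have : ({w₁ s} + {w₂ s} : Multiset ℕ) = {w s} + {min (w₁ s) (w₂ s)} := by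
          rcases hs.2 with h' | h'
          · rw [min_eq_right (h' ▸ h₂ s), h']
          · rw [min_eq_left (h' ▸ h₁ s), h', add_comm]
        rw [Multiset.filter_cons_of_pos _ hs,
          Multiset.filter_cons_of_neg (p := (¬ keep ·)) _ (not_not.2 hs)]
        simp only [Multiset.map_cons]
        simp only [← Multiset.singleton_add]
        calc _ = ({w₁ s} + {w₂ s}) + (m.map w₁ + m.map w₂) := by abel
          _ = _ := by rw [this, ih]; abel
      · rw [Multiset.filter_cons_of_neg (p := keep) _ hs,
          Multiset.filter_cons_of_pos (p := (¬ keep ·)) _ hs]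
        simp only [Multiset.map_cons]
        simp only [← Multiset.singleton_add]
        calc _ = ({w₁ s} + {w₂ s}) + (m.map w₁ + m.map w₂) := by abel
          _ = _ := by rw [ih]; abel
  have hmem : w s₀ ∈ (Finset.univ.val.filter (¬ keep ·)).map w :=
    Multiset.mem_map_of_mem w (Multiset.mem_filter.2 ⟨Finset.mem_univ s₀, by
      rintro ⟨-, h | h⟩ <;> omega⟩)
  refine ⟨(Finset.univ.val.filter keep).map w, _, (Finset.univ.val.filter (¬ keep ·)).map w,
    ?_, hsplit _, ?_, ?_⟩
  · intro h0
    rw [h0] at hmem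
    exact Multiset.notMem_zero _ hmem
  · rw [← Multiset.map_add, Multiset.filter_add_not]
  · have hlow : ∀ s, ¬ keep s → ∀ y, (y = w₁ s ∨ y = w₂ s) →
        ∃ z ∈ (Finset.univ.val.filter (¬ keep ·)).map w, y < z := by
      intro s hs y hy
      by_cases hk : k ≤ w s
      · refine ⟨w s, Multiset.mem_map_of_mem w (Multiset.mem_filter.2 ⟨Finset.mem_univ s, hs⟩), ?_⟩
        have h1 := h₁ s
        have h2 := h₂ s
        simp only [keep, hk, true_and, not_or] at hs
        omega
      · refine ⟨w s₀, hmem, ?_⟩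
        have h1 := h₁ s
        have h2 := h₂ s
        omega
    intro y hy
    simp only [Multiset.mem_add, Multiset.mem_map] at hy
    rcases hy with ⟨s, hs, rfl⟩ | ⟨s, hs, rfl⟩ | ⟨s, hs, rfl⟩
    · obtain ⟨hk, hs'⟩ := (Multiset.mem_filter.1 hs).2
      refine ⟨w s₀, hmem, ?_⟩
      have h1 := h₁₂ s hk
      have h2 := h₂₁ s hk
      omega
    · exact hlow s (Multiset.mem_filter.1 hs).2 _ (.inl rfl)
    · exact hlow s (Multiset.mem_filter.1 hs).2 _ (.inr rfl)

/-- If `k`-leanness fails, then the tree-decomposition can be split into a better one. -/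
lemma exists_split_isDershowitzMannaLT {α W : Type*} [Finite α] [Fintype W] {r : Set α → ℤ}
    {T : SimpleGraph W} {τ : α → W} {a b : W} {Z₁ Z₂ : Set α} {k : ℕ}
    (hr : IsPolymatroid r) (hT : T.IsTree) (hZ₁ : Z₁ ⊆ τ ⁻¹' {b}) (hZ₂ : Z₂ ⊆ τ ⁻¹' {a})
    (hk₁ : r Z₁ = k) (hk₂ : r Z₂ = k) (hex : ∃ X, Z₁ ⊆ X ∧ X ⊆ Z₂ᶜ ∧ conn r X < k)
    (p : T.Walk b a) (hp : p.IsPath)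
    (hpk : ∀ d ∈ p.darts, (k : ℤ) ≤ conn r (τ ⁻¹' side T d.fst d.snd)) :
    ∃ X, (∀ s, bagWidth r (doubleTree T a b) (splitMap τ X) (.inl s) ≤ bagWidth r T τ s) ∧
      (∀ s, bagWidth r (doubleTree T a b) (splitMap τ X) (.inr s) ≤ bagWidth r T τ s) ∧
      Multiset.IsDershowitzMannaLT
        (Finset.univ.val.map fun s =>
          (bagWidth r (doubleTree T a b) (splitMap τ X) s).toNat)
        (Finset.univ.val.map fun s => (bagWidth r T τ s).toNat) := by
  have hkpos : 0 < (k : ℤ) := by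
    obtain ⟨X, -, -, hX⟩ := hex
    exact (hr.conn_nonneg X).trans_lt hX
  have hne : ∀ Z : Set α, r Z = k → Z.Nonempty := by
    intro Z hZ
    rw [Set.nonempty_iff_ne_empty]
    rintro rfl
    rw [hr.empty] at hZ
    omega
  have hk : ∀ s u, T.Adj s u → a ∈ side T u s → b ∉ side T u s →
      (k : ℤ) ≤ conn r (τ ⁻¹' side T u s) := by
    intro s u hsu ha hb
    have hcut := (isEdgeCut_side hT hsu.symm).compl
    obtain ⟨d, hd, hdS, hdS'⟩ := p.exists_boundary_dart (side T u s)ᶜ hb (not_not.2 ha)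
    obtain ⟨h1, h2⟩ := hcut.eq_of_adj _ hdS _ hdS' d.adj
    have := hpk d hd
    rwa [h1, h2, ← side_compl hT hsu.symm, Set.preimage_compl, conn_compl] at this
  obtain ⟨X, hX₁, hX₂, hXk, hua, hub⟩ := exists_uncrossed hT hZ₁ hZ₂ (hne _ hk₁) (hne _ hk₂) hex hk
  have hX₂' : Z₂ ⊆ Xᶜ := Set.subset_compl_comm.1 hX₂
  have hX₁' : Z₁ ⊆ Xᶜᶜ := by rwa [compl_compl]
  have hXa : conn r X < r Z₂ := by rwa [hk₂]
  have hXb : conn r Xᶜ < r Z₁ := by rwa [conn_compl, hk₁]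
  have hle₁ := hua.cutWidth_le hr hT hZ₂ hX₂' hXa
  have hle₂ := hub.cutWidth_le hr hT hZ₁ hX₁' hXb
  have heq₁ := fun s => hua.exists_adj_of_cutWidth_eq hr hT hZ₂ hX₂' hXa (s := s)
  have heq₂ := fun s => hub.exists_adj_of_cutWidth_eq hr hT hZ₁ hX₁' hXb (s := s)
  have hnn := hr.bagWidth_nonneg hT τ
  refine ⟨X, ?_, ?_, ?_⟩
  · simpa only [bagWidth_doubleTree_inl r τ X hT] using hle₁
  · simpa only [bagWidth_doubleTree_inr r τ X hT] using hle₂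
  have huniv : (Finset.univ : Finset (W ⊕ W)).val =
      (Finset.univ.val.map Sum.inl + Finset.univ.val.map Sum.inr) := rfl
  rw [huniv, Multiset.map_add, Multiset.map_map, Multiset.map_map]
  simp only [Function.comp_def, bagWidth_doubleTree_inl r τ X hT, bagWidth_doubleTree_inr r τ X hT]
  refine isDershowitzMannaLT_map_add_map _ _ _ k (fun s => Int.toNat_le_toNat (hle₁ s))
    (fun s => Int.toNat_le_toNat (hle₂ s)) ?_ ?_ ?_
  · intro s hks hs
    have := hnn s
    have h1 := hle₁ s
    obtain ⟨u, hsu, -, huX⟩ := heq₁ s (by omega) (by omega)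
    have := hr.cutWidth_compl_le_conn hT hsu huX b
    omega
  · intro s hks hs
    have := hnn s
    have h1 := hle₂ s
    obtain ⟨u, hsu, -, huX⟩ := heq₂ s (by omega) (by omega)
    have := hr.cutWidth_compl_le_conn hT hsu huX a
    rw [compl_compl, conn_compl] at this
    omega
  · by_contra! hcon
    have hcon' : ∀ s, (k : ℤ) ≤ bagWidth r T τ s → cutWidth r T τ a X s ≠ bagWidth r T τ s →
        cutWidth r T τ b Xᶜ s = bagWidth r T τ s := by
      intro s hks hs
      have h1 := hcon s (by omega)
      have h2 := hle₁ s
      have h3 := hle₂ s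
      omega
    have ha := hr.cutWidth_self_lt hT hZ₂ hX₂' hXa
    have hb := hr.cutWidth_self_lt hT hZ₁ hX₁' hXb
    obtain ⟨d, hd, hd₁, hd₂⟩ := p.exists_boundary_dart
      {s | cutWidth r T τ a X s = bagWidth r T τ s}
      (by
        by_contra h
        exact hb.ne (hcon' b (hk₁ ▸ hr.le_bagWidth hT hZ₁) h)) ha.ne
    have hd_k := hpk d hd
    have hcut := isEdgeCut_side hT d.adj
    obtain ⟨hbd, had⟩ := hcut.mem_of_mem_darts hp hd
    have hk1 : (k : ℤ) ≤ bagWidth r T τ d.fst := by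
      refine hd_k.trans ?_
      rw [← conn_compl, ← Set.preimage_compl, side_compl hT d.adj]
      exact hr.conn_le_bagWidth hT τ d.adj
    have hk2 : (k : ℤ) ≤ bagWidth r T τ d.snd := hd_k.trans (hr.conn_le_bagWidth hT τ d.adj.symm)
    obtain ⟨u, hu, hau, huX⟩ := heq₁ d.fst hd₁ (by omega)
    obtain ⟨v, hv, hbv, hvX⟩ := heq₂ d.snd (hcon' _ hk2 hd₂) (by omega)
    rw [← Set.mem_compl_iff, side_compl hT d.adj] at had
    have hu' : u = d.snd := by
      by_contra hne
      exact Set.disjoint_left.1 (side_disjoint_side hT hu d.adj hne) hau had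
    have hv' : v = d.fst := by
      by_contra hne
      exact Set.disjoint_left.1 (side_disjoint_side hT hv d.adj.symm hne) hbv hbd
    rw [hu', ← Set.preimage_compl, side_compl hT d.adj.symm] at huX
    rw [hv'] at hvX
    have : τ ⁻¹' side T d.fst d.snd = X :=
      huX.antisymm (Set.compl_subset_compl.1 hvX)
    rw [this] at hd_k
    omega

lemma bagWidth_comap {α V W : Type*} [Fintype V] [Fintype W] (r : Set α → ℤ) {T : SimpleGraph W}
    (hT : T.IsTree) (τ : α → W) (e : V ≃ W) (v : V) :
    bagWidth r (T.comap e) (e.symm ∘ τ) v = bagWidth r T τ (e v) := by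
  have hT' : (T.comap e).IsTree := (SimpleGraph.Iso.comap e T).isTree_iff.2 hT
  rw [bagWidth, bagWidth]
  congr 1
  rw [← e.sum_comp]
  refine Finset.sum_congr rfl fun u _ => ?_
  by_cases hu : T.Adj (e v) (e u)
  · rw [if_pos hu, if_pos (by simpa), IsEdgeCut.side_eq hT'.connected (S := e ⁻¹' side T (e u) (e v))]
    · congr 1
      ext x
      simp
    · have := isEdgeCut_side hT hu.symm
      refine ⟨this.left_mem, this.right_notMem, fun a ha b hb hab => ?_⟩
      simpa using this.eq_of_adj (e a) ha (e b) hb hab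
  · rw [if_neg hu, if_neg (by simpa)]

section matroid
variable {α : Type*} [Finite α] (M : Matroid α)

lemma coe_mRank (X : Set α) : (mRank M X : ℕ∞) = M.eRk X := by
  have hbdd : BddAbove {k | ∃ I, I ⊆ X ∧ M.Indep I ∧ I.ncard = k} := by
    refine ⟨Nat.card α, ?_⟩
    rintro k ⟨I, -, -, rfl⟩
    exact Set.ncard_le_card I
  apply le_antisymm
  · obtain ⟨I, hIX, hI, hcard⟩ := Nat.sSup_mem
      (s := {k | ∃ I, I ⊆ X ∧ M.Indep I ∧ I.ncard = k})
      ⟨0, ∅, Set.empty_subset _, M.empty_indep, by simp⟩ hbdd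
    rw [mRank, ← hcard, (Set.toFinite I).cast_ncard_eq]
    exact hI.encard_le_eRk_of_subset hIX
  · rw [Matroid.eRk_le_iff]
    intro I hIX hI
    rw [← (Set.toFinite I).cast_ncard_eq]
    exact_mod_cast le_csSup hbdd ⟨I, hIX, hI, rfl⟩

lemma isPolymatroid_mRank : IsPolymatroid fun X => (mRank M X : ℤ) where
  empty := by
    have := coe_mRank M ∅
    rw [M.eRk_empty] at this
    exact_mod_cast this
  mono h := by
    have := M.eRk_mono h
    rw [← coe_mRank, ← coe_mRank] at this
    exact_mod_cast this
  submod X Y := by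
    have := M.eRk_inter_add_eRk_union_le X Y
    simp only [← coe_mRank] at this
    norm_cast at this ⊢
    omega

lemma coe_mConn (X : Set α) : (mConn M X : ℤ) = conn (fun X => (mRank M X : ℤ)) X := by
  have := (isPolymatroid_mRank M).conn_nonneg X
  simp only [conn, mConn] at this ⊢
  omega

lemma coe_mBagWidth {n : ℕ} {T : SimpleGraph (Fin n)} (hT : T.IsTree) (τ : α → Fin n)
    (v : Fin n) : (mBagWidth M T τ v : ℤ) = bagWidth (fun X => (mRank M X : ℤ)) T τ v := by
  have hnn := (isPolymatroid_mRank M).bagWidth_nonneg hT τ v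
  have hsum : ∑ d ∈ dartsTo T v, ((mRank M Set.univ : ℤ) - mRank M (τ ⁻¹' branch T d)ᶜ) =
      ∑ u ∈ Finset.univ.filter (T.Adj v),
        defect (fun X => (mRank M X : ℤ)) (τ ⁻¹' side T u v) := by
    refine Finset.sum_bij (fun d _ => d.fst) ?_ ?_ ?_ ?_
    · rintro ⟨⟨u, w⟩, h⟩ hd
      simp only [dartsTo, Finset.mem_filter, Finset.mem_univ, true_and] at hd ⊢
      subst hd
      exact h.symm
    · rintro ⟨⟨u, w⟩, h⟩ hd ⟨⟨u', w'⟩, h'⟩ hd' heq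
      simp only [dartsTo, Finset.mem_filter, Finset.mem_univ, true_and] at hd hd' heq
      subst hd hd' heq
      rfl
    · intro u hu
      exact ⟨⟨(u, v), by simpa [SimpleGraph.adj_comm] using hu⟩, by simp [dartsTo], rfl⟩
    · rintro ⟨⟨u, w⟩, h⟩ hd
      simp only [dartsTo, Finset.mem_filter, Finset.mem_univ, true_and] at hd
      subst hd
      rfl
  rw [bagWidth_eq] at hnn ⊢
  rw [← hsum, Finset.sum_sub_distrib] at hnn ⊢
  simp only [Finset.sum_const, nsmul_eq_mul, ← Nat.cast_sum, ← Nat.cast_mul] at hnn ⊢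
  simp only [mBagWidth]
  omega

end matroid

/-- Every tree-decomposition can be turned into a lean one without increasing the width. -/
lemma exists_lean_mWidth_le {α : Type*} [Finite α] (M : Matroid α) {n : ℕ}
    {T : SimpleGraph (Fin n)} (hT : T.IsTree) (τ : α → Fin n) :
    ∃ (n' : ℕ) (T' : SimpleGraph (Fin n')) (τ' : α → Fin n'),
      T'.IsTree ∧ mWidth M T' τ' ≤ mWidth M T τ ∧ IsLeanMDecomp M T' τ' := by
  induction hm : (Finset.univ.val.map (mBagWidth M T τ)) using
    (Multiset.wellFounded_isDershowitzMannaLT (α := ℕ)).induction generalizing n T τ with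
  | _ m ih
  subst hm
  by_cases hlean : IsLeanMDecomp M T τ
  · exact ⟨n, T, τ, hT, le_rfl, hlean⟩
  simp only [IsLeanMDecomp, not_forall, not_or, not_exists, not_and, not_le, not_lt] at hlean
  obtain ⟨k, b, a, Z₁, Z₂, hZ₁, hZ₂, hdisj, hk₁, hk₂, hlam, p, hp, hpk⟩ := hlean
  have hr := isPolymatroid_mRank M
  obtain ⟨X₀, ⟨hX₁, hX₂⟩, hX₀⟩ := Nat.sInf_mem (s := mConn M '' {X | Z₁ ⊆ X ∧ X ⊆ Z₂ᶜ})
    ⟨_, Z₁, ⟨subset_rfl, Set.disjoint_left.1 hdisj⟩, rfl⟩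
  obtain ⟨X, hle₁, hle₂, hlt⟩ := exists_split_isDershowitzMannaLT (k := k) hr hT hZ₁ hZ₂
    (by simp [hk₁]) (by simp [hk₂])
    ⟨X₀, hX₁, hX₂, by rw [← coe_mConn]; exact_mod_cast hX₀.trans_lt hlam⟩ p hp
    (fun d hd => by rw [← coe_mConn]; exact_mod_cast hpk d hd)
  have hD := doubleTree_isTree hT a b
  let e : Fin (n + n) ≃ Fin n ⊕ Fin n := finSumFinEquiv.symm
  have hT' : ((doubleTree T a b).comap e).IsTree := (SimpleGraph.Iso.comap e _).isTree_iff.2 hD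
  have hw : ∀ v, (mBagWidth M ((doubleTree T a b).comap e) (e.symm ∘ splitMap τ X) v : ℤ) =
      bagWidth (fun X => (mRank M X : ℤ)) (doubleTree T a b) (splitMap τ X) (e v) := fun v => by
    rw [coe_mBagWidth M hT', bagWidth_comap _ hD]
  have hlt' : Multiset.IsDershowitzMannaLT
      (Finset.univ.val.map (mBagWidth M ((doubleTree T a b).comap e) (e.symm ∘ splitMap τ X)))
      (Finset.univ.val.map (mBagWidth M T τ)) := by
    convert hlt using 1
    · rw [← Finset.map_univ_equiv e, Finset.map_val, Multiset.map_map]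
      refine Multiset.map_congr rfl fun v _ => ?_
      have := hw v
      simp only [Function.comp_apply, Equiv.coe_toEmbedding]
      omega
    · refine Multiset.map_congr rfl fun v _ => ?_
      have := coe_mBagWidth M hT τ v
      omega
  obtain ⟨n', T', τ', h₁, h₂, h₃⟩ := ih _ hlt' hT' (e.symm ∘ splitMap τ X) rfl
  refine ⟨n', T', τ', h₁, h₂.trans (Finset.sup_le fun v _ => ?_), h₃⟩
  have hv := hw v
  rcases hev : e v with s | s <;> rw [hev] at hv
  · have := hle₁ s
    rw [← coe_mBagWidth M hT, ← hv] at this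
    exact (Nat.cast_le.1 this).trans (Finset.le_sup (f := mBagWidth M T τ) (Finset.mem_univ s))
  · have := hle₂ s
    rw [← coe_mBagWidth M hT, ← hv] at this
    exact (Nat.cast_le.1 this).trans (Finset.le_sup (f := mBagWidth M T τ) (Finset.mem_univ s))

/-- Every matroid `M` admits a lean tree-decomposition of width `tw(M)`. -/
theorem matroid_admits_lean_treeDecomposition {α : Type*} [Fintype α] (M : Matroid α)
    (hE : M.E = Set.univ) :
    ∃ (n : ℕ) (T : SimpleGraph (Fin n)) (τ : α → Fin n),
      T.IsTree ∧ mWidth M T τ = matroidTreeWidth M ∧ IsLeanMDecomp M T τ := by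
  have hne : {w | ∃ (n : ℕ) (T : SimpleGraph (Fin n)) (_ : T.IsTree) (τ : α → Fin n),
      mWidth M T τ = w}.Nonempty :=
    ⟨_, 1, ⊥, SimpleGraph.IsTree.of_subsingleton, fun _ => 0, rfl⟩
  obtain ⟨n, T, hT, τ, hw⟩ := Nat.sInf_mem hne
  obtain ⟨n', T', τ', hT', hle, hlean⟩ := exists_lean_mWidth_le M hT τ
  exact ⟨n', T', τ', hT', le_antisymm (hle.trans hw.le) (Nat.sInf_le ⟨n', T', hT', τ', rfl⟩), hlean⟩
end
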